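/- If K is a miserly domain, then K has no corners: through each boundary point of K there passes exactly one supporting line of K. -/

import Mathlib

open MeasureTheory

noncomputable section

/-- The wedge (cross) product of two planar vectors. -/
def wedge (v w : ℝ × ℝ) : ℝ := v.1 * w.2 - v.2 * w.1

/-- A centrally symmetric convex domain in the plane. -/
def IsCSCD (K : Set (ℝ × ℝ)) : Prop :=
  Convex ℝ K ∧ IsCompact K ∧ (interior K).Nonempty ∧ K = -K

/-- The lattice spanned over `ℤ` by the vectors `v` and `w`. -/
def latticeOf (v w : ℝ × ℝ) : Set (ℝ × ℝ) :=
  {p | ∃ m n : ℤ, p = (m : ℝ) • v + (n : ℝ) • w}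

/-- `Λ + K` is a packing of `K`. -/
def IsPacking (K Λ : Set (ℝ × ℝ)) : Prop :=
  ∀ p ∈ Λ, ∀ q ∈ Λ, p ≠ q →
    interior ((fun x => p + x) '' K) ∩ interior ((fun x => q + x) '' K) = ∅

/-- The set of densities of lattice packings of `K`. -/
def packingDensities (K : Set (ℝ × ℝ)) : Set ℝ :=
  {d | ∃ v w : ℝ × ℝ, wedge v w ≠ 0 ∧ IsPacking K (latticeOf v w) ∧
       d = (volume K).toReal / |wedge v w|}

/-- `δ_lat(K)`: the supremum of densities of lattice packings of `K`. -/
def deltaLat (K : Set (ℝ × ℝ)) : ℝ := sSup (packingDensities K)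

/-- A miserly domain: a centrally symmetric convex domain minimizing `δ_lat`. -/
def IsMiserly (K : Set (ℝ × ℝ)) : Prop :=
  IsCSCD K ∧ ∀ K' : Set (ℝ × ℝ), IsCSCD K' → deltaLat K ≤ deltaLat K'

/-- `L` is a supporting line of `K` at the boundary point `p`. -/
def IsSupportingLineAt (K : Set (ℝ × ℝ)) (p : ℝ × ℝ) (L : Set (ℝ × ℝ)) : Prop :=
  ∃ f : (ℝ × ℝ) →ₗ[ℝ] ℝ, f ≠ 0 ∧ L = {x | f x = f p} ∧ ∀ x ∈ K, f x ≤ f p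

/-- `K` has no corners: through each boundary point of `K` there passes exactly
one supporting line of `K`. -/
def NoCorners (K : Set (ℝ × ℝ)) : Prop :=
  ∀ p ∈ frontier K, ∃! L : Set (ℝ × ℝ), IsSupportingLineAt K p L

/-- The lattice spanned by `u` and `w` meets `U` at most in the origin. -/
def Adm (U : Set (ℝ × ℝ)) (u w : ℝ × ℝ) : Prop :=
  ∀ m n : ℤ, (m ≠ 0 ∨ n ≠ 0) → (m : ℝ) • u + (n : ℝ) • w ∉ U

/-- The linear functional with coefficients `a`, `b` is bounded by `1` on `K`. -/
def Supp (K : Set (ℝ × ℝ)) (a b : ℝ) : Prop :=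
  ∀ x ∈ K, a * x.1 + b * x.2 ≤ 1

namespace IsCSCD

variable {K : Set (ℝ × ℝ)}

lemma neg_mem (hK : IsCSCD K) {x : ℝ × ℝ} (hx : x ∈ K) : -x ∈ K := by
  rw [hK.2.2.2]; simpa using hx

lemma neg_mem_interior (hK : IsCSCD K) {x : ℝ × ℝ} (hx : x ∈ interior K) :
    -x ∈ interior K := by
  have h : interior K = -interior K := by
    conv_lhs => rw [hK.2.2.2]
    exact (Homeomorph.neg (ℝ × ℝ)).preimage_interior K |>.symm
  rw [h]; simpa using hx

lemma zero_mem_interior (hK : IsCSCD K) : (0 : ℝ × ℝ) ∈ interior K := by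
  obtain ⟨x, hx⟩ := hK.2.2.1
  have := hK.1.interior hx (hK.neg_mem_interior hx) (a := 1 / 2) (b := 1 / 2)
    (by norm_num) (by norm_num) (by norm_num)
  simpa using this

lemma smul_mem_interior (hK : IsCSCD K) {x : ℝ × ℝ} (hx : x ∈ K) {c : ℝ} (hc : |c| < 1) :
    c • x ∈ interior K := by
  have key : ∀ y ∈ K, ∀ d : ℝ, 0 ≤ d → d < 1 → d • y ∈ interior K := fun y hy d h0 h1 => by
    have := hK.1.combo_interior_self_mem_interior hK.zero_mem_interior hy
      (a := 1 - d) (b := d) (by linarith) h0 (by ring)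
    simpa using this
  rcases le_total 0 c with h | h
  · exact key x hx c h (by rwa [abs_of_nonneg h] at hc)
  · have := key (-x) (hK.neg_mem hx) (-c) (by linarith) (by rwa [abs_of_nonpos h] at hc)
    simpa using this

lemma closure_interior (hK : IsCSCD K) : closure (interior K) = K := by
  rw [hK.1.closure_interior_eq_closure_of_nonempty_interior hK.2.2.1]
  exact hK.2.1.isClosed.closure_eq

end IsCSCD

lemma Supp.lt_one {K : Set (ℝ × ℝ)} {a b : ℝ} (h : Supp K a b) {x : ℝ × ℝ}
    (hx : x ∈ interior K) : a * x.1 + b * x.2 < 1 := by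
  have h1 : Filter.Tendsto (fun t : ℝ => (1 + t) • x) (nhds 0) (nhds x) := by
    have : Continuous (fun t : ℝ => (1 + t) • x) := by fun_prop
    simpa using this.tendsto 0
  have h2 := (h1.eventually (isOpen_interior.mem_nhds hx))
  obtain ⟨ε, hε, h3⟩ := Metric.eventually_nhds_iff.1 h2
  have h4 := h _ (interior_subset (h3 (y := ε / 2) (by
    rw [Real.dist_eq, sub_zero, abs_of_pos (by linarith)]; linarith)))
  simp only [Prod.smul_fst, Prod.smul_snd, smul_eq_mul] at h4
  by_contra h5
  push Not at h5
  nlinarith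

lemma Supp.neg_one_le {K : Set (ℝ × ℝ)} {a b : ℝ} (hK : IsCSCD K) (h : Supp K a b) {x : ℝ × ℝ}
    (hx : x ∈ K) : -1 ≤ a * x.1 + b * x.2 := by
  have := h _ (hK.neg_mem hx)
  simp only [Prod.fst_neg, Prod.snd_neg] at this
  linarith

lemma linear_apply (f : (ℝ × ℝ) →ₗ[ℝ] ℝ) (x : ℝ × ℝ) :
    f x = f (1, 0) * x.1 + f (0, 1) * x.2 := by
  have : x = x.1 • ((1 : ℝ), (0 : ℝ)) + x.2 • ((0 : ℝ), (1 : ℝ)) := by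
    ext <;> simp
  conv_lhs => rw [this]
  rw [map_add, map_smul, map_smul]
  simp [mul_comm]

lemma exists_supp_of_notMem_interior {K : Set (ℝ × ℝ)} (hK : IsCSCD K) {x : ℝ × ℝ}
    (hx : x ∉ interior K) : ∃ a b, Supp K a b ∧ a * x.1 + b * x.2 = 1 := by
  obtain ⟨f, hf⟩ := geometric_hahn_banach_open_point hK.1.interior isOpen_interior hx
  have h0 : 0 < f x := by simpa using hf 0 hK.zero_mem_interior
  have hle : ∀ y ∈ K, f y ≤ f x := by
    intro y hy
    rw [← hK.closure_interior] at hy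
    exact closure_minimal (fun z hz => (hf z hz).le)
      (isClosed_le f.continuous continuous_const) hy
  refine ⟨f (1, 0) / f x, f (0, 1) / f x, fun y hy => ?_, ?_⟩
  · have h1 := hle y hy
    have h2 := linear_apply f.toLinearMap y
    simp only [ContinuousLinearMap.coe_coe] at h2
    rw [div_mul_eq_mul_div, div_mul_eq_mul_div, ← add_div, ← h2, div_le_one h0]
    exact h1
  · have h2 := linear_apply f.toLinearMap x
    simp only [ContinuousLinearMap.coe_coe] at h2
    rw [div_mul_eq_mul_div, div_mul_eq_mul_div, ← add_div, ← h2, div_self h0.ne']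

lemma exists_supp_of_notMem {K : Set (ℝ × ℝ)} (hK : IsCSCD K) {x : ℝ × ℝ}
    (hx : x ∉ K) : ∃ a b, Supp K a b ∧ 1 < a * x.1 + b * x.2 := by
  obtain ⟨f, c, hf, hc⟩ := geometric_hahn_banach_closed_point hK.1 hK.2.1.isClosed hx
  have h0 : 0 < c := by simpa using hf 0 (interior_subset hK.zero_mem_interior)
  refine ⟨f (1, 0) / c, f (0, 1) / c, fun y hy => ?_, ?_⟩
  · have h1 := hf y hy
    have h2 := linear_apply f.toLinearMap y
    simp only [ContinuousLinearMap.coe_coe] at h2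
    rw [div_mul_eq_mul_div, div_mul_eq_mul_div, ← add_div, ← h2, div_le_one h0]
    exact h1.le
  · have h2 := linear_apply f.toLinearMap x
    simp only [ContinuousLinearMap.coe_coe] at h2
    rw [div_mul_eq_mul_div, div_mul_eq_mul_div, ← add_div, ← h2, lt_div_iff₀ h0, one_mul]
    exact hc

/-- A lattice whose generators `w`, `z` and their sum lie on the edges of a symmetric hexagon
circumscribed to `K`, in a suitable position, is admissible for the interior of `K`. -/
lemma adm_of_supp {K : Set (ℝ × ℝ)} (hK : IsCSCD K) {a b a₁ b₁ a₂ b₂ : ℝ}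
    (h : Supp K a b) (h₁ : Supp K a₁ b₁) (h₂ : Supp K a₂ b₂) {w z : ℝ × ℝ}
    (hu : a * (w.1 + z.1) + b * (w.2 + z.2) = 1)
    (hw : a₁ * w.1 + b₁ * w.2 = 1) (hz : a₂ * z.1 + b₂ * z.2 = 1)
    (hw0 : 0 ≤ a * w.1 + b * w.2) (hw1 : a * w.1 + b * w.2 ≤ 1)
    (hs : a₁ * z.1 + b₁ * z.2 ≤ 0 ∨ a₂ * w.1 + b₂ * w.2 ≤ 0) :
    Adm (interior K) w z := by
  have key : ∀ m n : ℤ, (0 < m ∨ (m = 0 ∧ 0 < n)) →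
      (m : ℝ) • w + (n : ℝ) • z ∉ interior K := by
    intro m n hmn hx
    have e := h.lt_one hx
    have e₁ := h₁.lt_one hx
    have e₂ := h₂.lt_one hx
    have e₂' := h₂.lt_one (hK.neg_mem_interior hx)
    simp only [Prod.fst_add, Prod.snd_add, Prod.fst_neg, Prod.snd_neg, Prod.smul_fst,
      Prod.smul_snd, smul_eq_mul] at e e₁ e₂ e₂'
    rcases hmn with hm | ⟨rfl, hn⟩
    · have hm' : (1 : ℝ) ≤ m := by exact_mod_cast hm
      rcases lt_trichotomy n 0 with hn | rfl | hn
      · have hn' : (n : ℝ) ≤ -1 := by exact_mod_cast Int.le_sub_one_of_lt hn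
        rcases hs with hs | hs
        · nlinarith
        · nlinarith
      · simp at e₁
        nlinarith
      · have hn' : (1 : ℝ) ≤ n := by exact_mod_cast hn
        nlinarith [mul_nonneg (sub_nonneg.2 hm') hw0,
          mul_nonneg (sub_nonneg.2 hn') (sub_nonneg.2 hw1)]
    · have hn' : (1 : ℝ) ≤ n := by exact_mod_cast hn
      simp at e₂
      nlinarith
  intro m n hmn hx
  by_cases hc : 0 < m ∨ (m = 0 ∧ 0 < n)
  · exact key m n hc hx
  · refine key (-m) (-n) (by omega) ?_
    have := hK.neg_mem_interior hx
    convert this using 1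
    push_cast
    module

/-- If the parallelogram cut out by two supporting strips of a critical configuration has a
vertex outside of `K`, the lattice is not optimal. -/
lemma eq_square_of_minimal {K : Set (ℝ × ℝ)} (hK : IsCSCD K)
    (hmin : ∀ u w : ℝ × ℝ, wedge u w ≠ 0 → Adm (interior K) u w → 1 ≤ |wedge u w|)
    (hw : ((1 : ℝ), (0 : ℝ)) ∈ K) (hz : ((0 : ℝ), (1 : ℝ)) ∈ K) (hu : ((1 : ℝ), (1 : ℝ)) ∈ K)
    (h₁ : Supp K 1 0) (h₂ : Supp K 0 1) :
    ∀ x : ℝ × ℝ, x ∈ K ↔ |x.1| ≤ 1 ∧ |x.2| ≤ 1 := by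
  have hc : ((1 : ℝ), (-1 : ℝ)) ∈ K := by
    by_contra hc
    obtain ⟨α, β, hs, hgt⟩ := exists_supp_of_notMem hK hc
    have e1 := hs _ hw
    have e2 := hs _ (hK.neg_mem hz)
    have e3 := hs _ hu
    simp only [Prod.fst_neg, Prod.snd_neg] at e1 e2 e3 hgt
    have hα : 0 < α := by linarith
    have hβ : β < 0 := by linarith
    obtain ⟨x, hx⟩ : ∃ x, x = (1 + β) / α := ⟨_, rfl⟩
    obtain ⟨y, hy⟩ : ∃ y, y = (1 - α) / (-β) := ⟨_, rfl⟩
    have hx0 : 0 ≤ x := by rw [hx]; exact div_nonneg (by linarith) hα.le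
    have hy0 : 0 ≤ y := by rw [hy]; exact div_nonneg (by linarith) (by linarith)
    have hx1 : x < 1 := by rw [hx, div_lt_one hα]; linarith
    have hy1 : y < 1 := by rw [hy, div_lt_one (by linarith)]; linarith
    have hxe : α * x = 1 + β := by rw [hx]; field_simp
    have hye : -β * y = 1 - α := by
      rw [hy, mul_div_cancel₀]; linarith
    have hadm : Adm (interior K) ((1 + x) / 2, -(1 + y) / 2) ((1 - x) / 2, 1) := by
      refine adm_of_supp hK h₁ hs h₂ ?_ ?_ ?_ ?_ ?_ ?_ <;> simp only
      · ring
      · linarith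
      · ring
      · linarith
      · linarith
      · right; linarith
    have hpos : 0 < (1 - x) * (1 - y) := mul_pos (by linarith) (by linarith)
    have hlt : (1 - x) * (1 - y) ≤ 1 := by nlinarith
    have hwe : wedge ((1 + x) / 2, -(1 + y) / 2) ((1 - x) / 2, 1) = 1 - (1 - x) * (1 - y) / 4 := by
      unfold wedge; ring
    have := hmin _ _ (by rw [hwe]; linarith) hadm
    rw [hwe, abs_of_pos (by linarith)] at this
    linarith
  intro x
  constructor
  · intro hx
    have e1 := h₁ x hx
    have e2 := h₂ x hx
    have e3 := h₁.neg_one_le hK hx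
    have e4 := h₂.neg_one_le hK hx
    exact ⟨abs_le.2 ⟨by linarith, by linarith⟩, abs_le.2 ⟨by linarith, by linarith⟩⟩
  · rintro ⟨hx1, hx2⟩
    rw [abs_le] at hx1 hx2
    have a1 : ((1 : ℝ), x.2) ∈ K := by
      have := hK.1 hu hc (show 0 ≤ (1 + x.2) / 2 by linarith) (show 0 ≤ (1 - x.2) / 2 by linarith)
        (by ring)
      convert this using 1
      ext <;> simp <;> ring
    have a2 : ((-1 : ℝ), x.2) ∈ K := by
      have := hK.1 (hK.neg_mem hu) (hK.neg_mem hc) (show 0 ≤ (1 - x.2) / 2 by linarith)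
        (show 0 ≤ (1 + x.2) / 2 by linarith) (by ring)
      convert this using 1
      ext <;> simp <;> ring
    have := hK.1 a1 a2 (show 0 ≤ (1 + x.1) / 2 by linarith)
      (show 0 ≤ (1 - x.1) / 2 by linarith)
        (by ring)
    convert this using 1
    ext <;> simp <;> ring

/-- The hexagon with midpoints obtained from three supporting strips of `K` shows that the
contact points of an optimal lattice are midpoints of the edges. -/
lemma midpoint_condition {K : Set (ℝ × ℝ)} (hK : IsCSCD K)
    (hmin : ∀ u w : ℝ × ℝ, wedge u w ≠ 0 → Adm (interior K) u w → 1 ≤ |wedge u w|)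
    {q r s : ℝ} (hq0 : 0 < q) (hq1 : q < 1) (hr0 : 0 ≤ r) (hr1 : r ≤ 1) (hs0 : 0 ≤ s)
    (hs1 : s ≤ 1) (hP : 0 < 1 - r * s)
    (h : Supp K q (1 - q)) (h₁ : Supp K 1 (-s)) (h₂ : Supp K (-r) 1) :
    (1 - q) * (r * (1 - s)) - q * (s * (1 - r)) = 0 := by
  by_contra hN
  set N := (1 - q) * (r * (1 - s)) - q * (s * (1 - r)) with hNdef
  set P := 1 - r * s with hPdef
  obtain ⟨A, hA⟩ : ∃ A, A = 1 - q + q * s := ⟨_, rfl⟩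
  obtain ⟨B, hB⟩ : ∃ B, B = q + (1 - q) * r := ⟨_, rfl⟩
  have hqs := mul_nonneg hq0.le hs0
  have hqr := mul_nonneg (sub_nonneg.2 hq1.le) hr0
  have hA0 : 0 < A := by linarith
  have hB0 : 0 < B := by linarith
  obtain ⟨a, ha⟩ : ∃ a, a = N / (2 * A * P) := ⟨_, rfl⟩
  obtain ⟨b, hb⟩ : ∃ b, b = -N / (2 * B * P) := ⟨_, rfl⟩
  have haA : a * A = N / (2 * P) := by rw [ha]; field_simp
  have hbB : b * B = -(N / (2 * P)) := by rw [hb]; field_simp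
  have haP : a * P = N / (2 * A) := by rw [ha]; field_simp
  have hbP : b * P = -N / (2 * B) := by rw [hb]; field_simp
  have hwe : wedge (1 + a * s, a) (b, 1 + b * r) = 1 - N ^ 2 / (4 * P * A * B) := by
    have e1 : wedge (1 + a * s, a) (b, 1 + b * r) = 1 + (a * s + b * r) - a * b * P := by
      unfold wedge; rw [hPdef]; ring
    have e2 : s * B - r * A = - N := by rw [hA, hB, hNdef]; ring
    have e3 : a * s + b * r = N * (s * B - r * A) / (2 * P * A * B) := by
      rw [ha, hb]; field_simp; ring
    rw [e1, e3, e2, ha, hb]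
    field_simp
    ring
  have hrs : 0 ≤ r * (1 - s) := mul_nonneg hr0 (by linarith)
  have hsr : 0 ≤ s * (1 - r) := mul_nonneg hs0 (by linarith)
  have hP1 : r * (1 - s) ≤ P := by linarith
  have hP2 : s * (1 - r) ≤ P := by linarith
  have hX0 := mul_nonneg (sub_nonneg.2 hq1.le) hrs
  have hY0 := mul_nonneg hq0.le hsr
  have hNX : N ≤ (1 - q) * (r * (1 - s)) := by linarith
  have hNY : -N ≤ q * (s * (1 - r)) := by linarith
  have hF0 : 0 ≤ q + N / (2 * P) := by
    have : -q ≤ N / (2 * P) := by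
      rw [le_div_iff₀ (by linarith)]
      nlinarith [mul_le_mul_of_nonneg_left hP2 hq0.le, mul_pos hq0 hP]
    linarith
  have hF1 : q + N / (2 * P) ≤ 1 := by
    have : N / (2 * P) ≤ 1 - q := by
      rw [div_le_iff₀ (by linarith)]
      nlinarith [mul_le_mul_of_nonneg_left hP1 (sub_nonneg.2 hq1.le), mul_pos (sub_pos.2 hq1) hP]
    linarith
  have hadm : Adm (interior K) (1 + a * s, a) (b, 1 + b * r) := by
    have eF : q * (1 + a * s) + (1 - q) * a = q + a * A := by rw [hA]; ring
    refine adm_of_supp hK h h₁ h₂ ?_ ?_ ?_ ?_ ?_ ?_ <;> simp only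
    · have : q * (1 + a * s + b) + (1 - q) * (a + (1 + b * r)) = 1 + a * A + b * B := by
        rw [hA, hB]; ring
      rw [this, haA, hbB]; ring
    · ring
    · ring
    · rw [eF, haA]; exact hF0
    · rw [eF, haA]; exact hF1
    · have e1 : 1 * b + -s * (1 + b * r) = -s + b * P := by rw [hPdef]; ring
      have e2 : -r * (1 + a * s) + 1 * a = -r + a * P := by rw [hPdef]; ring
      rw [e1, e2, haP, hbP]
      rcases le_total 0 N with hN0 | hN0
      · left
        have : -N / (2 * B) ≤ 0 := div_nonpos_of_nonpos_of_nonneg (by linarith) (by linarith)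
        linarith
      · right
        have : N / (2 * A) ≤ 0 := div_nonpos_of_nonpos_of_nonneg (by linarith) (by linarith)
        linarith
  have hPAB : 0 < P * A * B := by positivity
  have hNsq : N ^ 2 ≤ P * A * B := by
    rcases le_total 0 N with hN0 | hN0
    · calc N ^ 2 ≤ ((1 - q) * (r * (1 - s))) ^ 2 := pow_le_pow_left₀ hN0 hNX 2
        _ = (r * (1 - s)) * ((1 - q) * (1 - s)) * ((1 - q) * r) := by ring
        _ ≤ P * A * B := by
          have : (1 - q) * (1 - s) ≤ A := by rw [hA]; linarith
          have h0 : 0 ≤ (1 - q) * (1 - s) := mul_nonneg (by linarith) (by linarith)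
          gcongr
          linarith
    · calc N ^ 2 = (-N) ^ 2 := by ring
        _ ≤ (q * (s * (1 - r))) ^ 2 := pow_le_pow_left₀ (by linarith) hNY 2
        _ = (s * (1 - r)) * (q * s) * (q * (1 - r)) := by ring
        _ ≤ P * A * B := by
          have : q * (1 - r) ≤ B := by rw [hB]; linarith
          have h0 : 0 ≤ q * (1 - r) := mul_nonneg (by linarith) (by linarith)
          gcongr
          linarith
  have hpos : 0 < N ^ 2 / (4 * P * A * B) := by positivity
  have hlt : N ^ 2 / (4 * P * A * B) < 1 := by
    rw [div_lt_one (by positivity)]; linarith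
  have := hmin _ _ (by rw [hwe]; linarith) hadm
  rw [hwe, abs_of_pos (by linarith)] at this
  linarith

/-- A critical configuration with a corner at a lattice point is a parallelogram. -/
lemma eq_square_of_corner {K : Set (ℝ × ℝ)} (hK : IsCSCD K)
    (hadm : Adm (interior K) (1, 0) (0, 1))
    (hmin : ∀ u w : ℝ × ℝ, wedge u w ≠ 0 → Adm (interior K) u w → 1 ≤ |wedge u w|)
    (hw : ((1 : ℝ), (0 : ℝ)) ∈ K) (hz : ((0 : ℝ), (1 : ℝ)) ∈ K) (hu : ((1 : ℝ), (1 : ℝ)) ∈ K)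
    {q₁ q₂ : ℝ} (hq : q₁ < q₂) (h₁ : Supp K q₁ (1 - q₁)) (h₂ : Supp K q₂ (1 - q₂)) :
    ∀ x : ℝ × ℝ, x ∈ K ↔ |x.1| ≤ 1 ∧ |x.2| ≤ 1 := by
  have hq0 : 0 ≤ q₁ := by simpa using h₁ _ hz
  have hq1 : q₂ ≤ 1 := by simpa using h₂ _ hw
  have hwi : ((1 : ℝ), (0 : ℝ)) ∉ interior K := by simpa using hadm 1 0 (by simp)
  have hzi : ((0 : ℝ), (1 : ℝ)) ∉ interior K := by simpa using hadm 0 1 (by simp)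
  obtain ⟨a₁, s, hg₁, hgw⟩ := exists_supp_of_notMem_interior hK hwi
  obtain ⟨r, b₂, hg₂, hgz⟩ := exists_supp_of_notMem_interior hK hzi
  obtain rfl : a₁ = 1 := by simpa using hgw
  obtain rfl : b₂ = 1 := by simpa using hgz
  obtain ⟨s, rfl⟩ : ∃ t, s = -t := ⟨-s, by ring⟩
  obtain ⟨r, rfl⟩ : ∃ t, r = -t := ⟨-r, by ring⟩
  have hs0 : 0 ≤ s := by simpa using hg₁ _ hu
  have hs1 : s ≤ 1 := by simpa using hg₁ _ (hK.neg_mem hz)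
  have hr0 : 0 ≤ r := by simpa using hg₂ _ hu
  have hr1 : r ≤ 1 := by simpa using hg₂ _ (hK.neg_mem hw)
  have hconv : ∀ t : ℝ, 0 ≤ t → t ≤ 1 →
      Supp K (q₁ + t * (q₂ - q₁)) (1 - (q₁ + t * (q₂ - q₁))) := by
    intro t ht0 ht1 x hx
    have e1 := h₁ x hx
    have e2 := h₂ x hx
    nlinarith [mul_le_mul_of_nonneg_left e1 (sub_nonneg.2 ht1), mul_le_mul_of_nonneg_left e2 ht0]
  rcases eq_or_lt_of_le (show r * s ≤ 1 by nlinarith) with hrs | hrs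
  · obtain rfl : r = 1 := by nlinarith
    obtain rfl : s = 1 := by linarith
    exfalso
    have ha : Adm (interior K) ((1 + q₁) / 2, 1 + q₁ / 2)
        (1 - (q₁ + q₂) / 2, -(q₁ + q₂) / 2) := by
      refine adm_of_supp hK h₂ h₁ hg₁ ?_ ?_ ?_ ?_ ?_ ?_ <;> simp only
      · ring
      · ring
      · ring
      · nlinarith
      · nlinarith
      · left; nlinarith
    have hwe : wedge ((1 + q₁) / 2, 1 + q₁ / 2) (1 - (q₁ + q₂) / 2, -(q₁ + q₂) / 2)
        = -(1 - (q₂ - q₁) / 4) := by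
      unfold wedge; ring
    have := hmin _ _ (by rw [hwe]; linarith) ha
    rw [hwe, abs_neg, abs_of_pos (by linarith)] at this
    linarith
  · have hm : ∀ t : ℝ, 0 < t → t < 1 → _ := fun t ht0 ht1 =>
      midpoint_condition hK hmin (q := q₁ + t * (q₂ - q₁)) (by nlinarith) (by nlinarith) hr0 hr1 hs0
        hs1 (by linarith) (hconv t ht0.le ht1.le) hg₁ hg₂
    have e1 := hm (1 / 2) (by norm_num) (by norm_num)
    have e2 := hm (1 / 3) (by norm_num) (by norm_num)
    have e3 : (q₂ - q₁) * (r * (1 - s) + s * (1 - r)) = 0 := by linarith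
    have e4 : r * (1 - s) + s * (1 - r) = 0 :=
      (mul_eq_zero.1 e3).resolve_left (by linarith)
    have e5 : 0 ≤ r * (1 - s) := mul_nonneg hr0 (by linarith)
    have e6 : 0 ≤ s * (1 - r) := mul_nonneg hs0 (by linarith)
    have e7 : r * (1 - s) = 0 := by linarith
    have e8 : s * (1 - r) = 0 := by linarith
    have e9 : r = s := by linarith
    subst e9
    have e10 : r = 0 := by
      rcases mul_eq_zero.1 e7 with h | h
      · exact h
      · nlinarith
    subst e10
    exact eq_square_of_minimal hK hmin hw hz hu (by simpa using hg₁) (by simpa using hg₂)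

/-- The linear automorphism of the plane taking the standard basis to `u`, `w`. -/
def latEquiv (u w : ℝ × ℝ) (h : wedge u w ≠ 0) : (ℝ × ℝ) ≃L[ℝ] (ℝ × ℝ) :=
  LinearEquiv.toContinuousLinearEquiv
    { toFun := fun x => x.1 • u + x.2 • w
      map_add' := fun x y => by simp only [Prod.fst_add, Prod.snd_add]; module
      map_smul' := fun c x => by
        simp only [Prod.smul_fst, Prod.smul_snd, smul_eq_mul, RingHom.id_apply]; module
      invFun := fun y => (wedge y w / wedge u w, wedge u y / wedge u w)
      left_inv := fun x => by
        ext <;> simp only [wedge, Prod.fst_add, Prod.snd_add, Prod.smul_fst, Prod.smul_snd,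
          smul_eq_mul] at h ⊢ <;> rw [div_eq_iff h] <;> ring
      right_inv := fun x => by
        ext <;> simp only [wedge, Prod.fst_add, Prod.snd_add, Prod.smul_fst, Prod.smul_snd,
          smul_eq_mul] at h ⊢ <;>
          rw [div_mul_eq_mul_div, div_mul_eq_mul_div, ← add_div, div_eq_iff h] <;> ring }

lemma latEquiv_apply (u w : ℝ × ℝ) (h : wedge u w ≠ 0) (x : ℝ × ℝ) :
    latEquiv u w h x = x.1 • u + x.2 • w := rfl

lemma wedge_latEquiv (u w : ℝ × ℝ) (h : wedge u w ≠ 0) (x y : ℝ × ℝ) :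
    wedge (latEquiv u w h x) (latEquiv u w h y) = wedge u w * wedge x y := by
  simp only [latEquiv_apply, wedge, Prod.fst_add, Prod.snd_add, Prod.smul_fst, Prod.smul_snd,
    smul_eq_mul]
  ring

lemma interior_preimage (T : (ℝ × ℝ) ≃L[ℝ] (ℝ × ℝ)) (K : Set (ℝ × ℝ)) :
    interior (T ⁻¹' K) = T ⁻¹' interior K :=
  (T.toHomeomorph.preimage_interior K).symm

lemma IsCSCD.preimage {K : Set (ℝ × ℝ)} (hK : IsCSCD K) (T : (ℝ × ℝ) ≃L[ℝ] (ℝ × ℝ)) :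
    IsCSCD (T ⁻¹' K) := by
  refine ⟨hK.1.linear_preimage T.toLinearEquiv.toLinearMap,
    T.toHomeomorph.isCompact_preimage.2 hK.2.1, ?_, ?_⟩
  · rw [interior_preimage]
    exact ⟨0, by simpa using hK.zero_mem_interior⟩
  · ext x
    rw [Set.mem_neg, Set.mem_preimage, Set.mem_preimage, map_neg]
    conv_lhs => rw [hK.2.2.2]
    rw [Set.mem_neg]

lemma adm_preimage {K : Set (ℝ × ℝ)} (T : (ℝ × ℝ) ≃L[ℝ] (ℝ × ℝ)) (u w : ℝ × ℝ) :
    Adm (interior (T ⁻¹' K)) u w ↔ Adm (interior K) (T u) (T w) := by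
  rw [interior_preimage]
  simp [Adm]

/-- The lattice spanned by `u` and `w` is an admissible lattice of least determinant. -/
def Crit (K : Set (ℝ × ℝ)) (u w : ℝ × ℝ) : Prop :=
  IsCSCD K ∧ wedge u w ≠ 0 ∧ Adm (interior K) u w ∧
    ∀ u' w', wedge u' w' ≠ 0 → Adm (interior K) u' w' → |wedge u w| ≤ |wedge u' w'|

lemma Crit.minimal_preimage {K : Set (ℝ × ℝ)} {u w : ℝ × ℝ} (h : Crit K u w) (u' w' : ℝ × ℝ)
    (hne : wedge u' w' ≠ 0) (hadm : Adm (interior (latEquiv u w h.2.1 ⁻¹' K)) u' w') :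
    1 ≤ |wedge u' w'| := by
  have h1 := h.2.2.2 (latEquiv u w h.2.1 u') (latEquiv u w h.2.1 w')
    (by rw [wedge_latEquiv]; exact mul_ne_zero h.2.1 hne) ((adm_preimage _ _ _).1 hadm)
  rw [wedge_latEquiv, abs_mul] at h1
  exact le_of_mul_le_mul_left (by linarith) (abs_pos.2 h.2.1)

lemma Crit.adm_preimage_basis {K : Set (ℝ × ℝ)} {u w : ℝ × ℝ} (h : Crit K u w) :
    Adm (interior (latEquiv u w h.2.1 ⁻¹' K)) (1, 0) (0, 1) := by
  rw [adm_preimage]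
  simpa [latEquiv_apply] using h.2.2.1

lemma exists_pos_add_mem {K : Set (ℝ × ℝ)} {x y : ℝ} (h : (x, y) ∈ interior K) :
    ∃ ε > 0, (x + ε, y) ∈ K := by
  have h1 : Filter.Tendsto (fun t : ℝ => (x + t, y)) (nhds 0) (nhds (x, y)) := by
    have : Continuous (fun t : ℝ => (x + t, y)) := by fun_prop
    simpa using this.tendsto 0
  have h2 := (h1.eventually (isOpen_interior.mem_nhds h))
  obtain ⟨ε, hε, h3⟩ := Metric.eventually_nhds_iff.1 h2
  exact ⟨ε / 2, by linarith, interior_subset (h3 (y := ε / 2) (by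
    rw [Real.dist_eq, sub_zero, abs_of_pos (by linarith)]; linarith))⟩

/-- Below the height of a critical lattice, the chords of `K` parallel to a lattice vector on
the boundary are long. -/
lemma exists_chord_of_lt {K : Set (ℝ × ℝ)} (hK : IsCSCD K)
    (hadm : Adm (interior K) (1, 0) (0, 1))
    (hmin : ∀ u w : ℝ × ℝ, wedge u w ≠ 0 → Adm (interior K) u w → 1 ≤ |wedge u w|)
    (hu : ((1 : ℝ), (0 : ℝ)) ∈ K) {y : ℝ} (hy0 : 0 < y) (hy1 : y < 1) :
    ∃ a : ℝ, (a, y) ∈ K ∧ (a + 1, y) ∈ K := by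
  have key : ∀ b : ℝ, ∃ m n : ℤ, 1 ≤ n ∧ ((m : ℝ) + n * b, n * y) ∈ interior K := by
    intro b
    have hwe : wedge ((1 : ℝ), (0 : ℝ)) (b, y) = y := by simp [wedge]
    have h1 : ¬ Adm (interior K) (1, 0) (b, y) := fun h => by
      have := hmin _ _ (by rw [hwe]; exact hy0.ne') h
      rw [hwe, abs_of_pos hy0] at this
      linarith
    unfold Adm at h1
    push Not at h1
    obtain ⟨m, n, hmn, hx⟩ := h1
    rcases lt_trichotomy n 0 with hn | rfl | hn
    · refine ⟨-m, -n, by omega, ?_⟩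
      convert hK.neg_mem_interior hx using 1
      ext <;> simp <;> ring
    · exact absurd hx (by simpa using hadm m 0 (by simpa using hmn))
    · refine ⟨m, n, by omega, ?_⟩
      convert hx using 1
      ext <;> simp
  have hscale : ∀ (m n : ℤ) (b : ℝ), 1 ≤ n → ((m : ℝ) + n * b, n * y) ∈ interior K →
      ((m : ℝ) / n + b, y) ∈ K := by
    intro m n b hn hx
    have hn' : (1 : ℝ) ≤ n := by exact_mod_cast hn
    have := hK.1 (interior_subset hx) (interior_subset hK.zero_mem_interior)
      (show 0 ≤ 1 / (n : ℝ) by positivity)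
      (show 0 ≤ 1 - 1 / (n : ℝ) by rw [sub_nonneg, div_le_one (by linarith)]; exact hn') (by ring)
    convert this using 1
    ext
    · simp; field_simp
    · simp; field_simp
  obtain ⟨m₀, n₀, hn₀, hx₀⟩ := key 0
  have hne : (K ∩ {x | x.2 = y}).Nonempty := ⟨_, hscale m₀ n₀ 0 hn₀ hx₀, rfl⟩
  have hcomp : IsCompact (K ∩ {x | x.2 = y}) :=
    hK.2.1.inter_right (isClosed_eq continuous_snd continuous_const)
  obtain ⟨⟨b, y'⟩, ⟨hbK, hby⟩, hmax⟩ := hcomp.exists_isMaxOn hne continuous_fst.continuousOn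
  obtain rfl : y' = y := hby
  obtain ⟨m, n, hn, hx⟩ := key b
  rcases eq_or_lt_of_le hn with rfl | hn
  · have hx' : ((m : ℝ) + b, y') ∈ interior K := by simpa using hx
    obtain ⟨ε, hε, hεK⟩ := exists_pos_add_mem hx'
    have h1 : (m : ℝ) + b + ε ≤ b := hmax ⟨hεK, rfl⟩
    have h2 : m < 0 := by
      have : (m : ℝ) < 0 := by linarith
      exact_mod_cast this
    have h3 : (m : ℝ) ≤ -1 := by exact_mod_cast Int.le_sub_one_of_lt h2
    refine ⟨b - 1, ?_, by simpa using hbK⟩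
    have hm : (m : ℝ) ≠ 0 := by linarith
    have h4 : 0 ≤ 1 / (-m : ℝ) := by apply div_nonneg <;> linarith
    have h5 : 1 / (-m : ℝ) ≤ 1 := by rw [div_le_one] <;> linarith
    have := hK.1 (interior_subset hx') hbK h4 (sub_nonneg.2 h5) (by ring)
    convert this using 1
    ext
    · simp; field_simp; ring
    · simp; ring
  · have hn' : (2 : ℝ) ≤ n := by exact_mod_cast hn
    have hinv : 1 / (n : ℝ) ≤ 1 / 2 := by
      rw [div_le_div_iff₀ (by linarith) (by norm_num)]; linarith
    have hseg : ∀ t : ℝ, |t| ≤ 1 / 2 → ((m : ℝ) / n + b + t, y') ∈ K := by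
      intro t ht
      obtain ⟨c, hc⟩ : ∃ c, c = t / (1 - 1 / (n : ℝ)) := ⟨_, rfl⟩
      have hc1 : |c| ≤ 1 := by
        rw [hc, abs_div, abs_of_pos (show 0 < 1 - 1 / (n : ℝ) by linarith),
          div_le_one (by linarith)]
        linarith
      have hct : (1 - 1 / (n : ℝ)) * c = t := by
        rw [hc, mul_div_cancel₀]; linarith
      rw [abs_le] at hc1
      have hcK : (c, (0 : ℝ)) ∈ K := by
        have := hK.1 hu (hK.neg_mem hu) (show 0 ≤ (1 + c) / 2 by linarith)
          (show 0 ≤ (1 - c) / 2 by linarith) (by ring)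
        convert this using 1
        ext
        · simp; ring
        · simp
      have := hK.1 (interior_subset hx) hcK (show 0 ≤ 1 / (n : ℝ) by positivity)
        (show 0 ≤ 1 - 1 / (n : ℝ) by linarith) (by ring)
      convert this using 1
      ext
      · simp only [Prod.fst_add, Prod.smul_fst, smul_eq_mul]
        rw [hct]; field_simp
      · simp; field_simp
    refine ⟨m / n + b + (-(1 / 2)), hseg _ (by rw [abs_neg, abs_of_pos] <;> norm_num), ?_⟩
    convert hseg (1 / 2) (by rw [abs_of_pos] <;> norm_num) using 2
    ring

lemma exists_chord {K : Set (ℝ × ℝ)} (hK : IsCSCD K)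
    (hadm : Adm (interior K) (1, 0) (0, 1))
    (hmin : ∀ u w : ℝ × ℝ, wedge u w ≠ 0 → Adm (interior K) u w → 1 ≤ |wedge u w|)
    (hu : ((1 : ℝ), (0 : ℝ)) ∈ K) : ∃ a : ℝ, (a, 1) ∈ K ∧ (a + 1, 1) ∈ K := by
  have hcl : IsClosed (Prod.snd '' (K ∩ (fun x : ℝ × ℝ => (x.1 + 1, x.2)) ⁻¹' K)) := by
    refine ((hK.2.1.inter_right ?_).image continuous_snd).isClosed
    exact hK.2.1.isClosed.preimage (by fun_prop)
  have hsub : Set.Ioo (0 : ℝ) 1 ⊆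
      Prod.snd '' (K ∩ (fun x : ℝ × ℝ => (x.1 + 1, x.2)) ⁻¹' K) := by
    intro y hy
    obtain ⟨a, h1, h2⟩ := exists_chord_of_lt hK hadm hmin hu hy.1 hy.2
    exact ⟨(a, y), ⟨h1, h2⟩, rfl⟩
  have h1 : (1 : ℝ) ∈ closure (Set.Ioo (0 : ℝ) 1) := by
    rw [closure_Ioo (by norm_num)]; simp
  obtain ⟨⟨a, y⟩, ⟨h2, h3⟩, rfl⟩ := closure_minimal hsub hcl h1
  exact ⟨a, h2, h3⟩

lemma exists_adm_boundary {K : Set (ℝ × ℝ)} (hK : IsCSCD K)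
    (hadm : Adm (interior K) (1, 0) (0, 1))
    (hmin : ∀ u w : ℝ × ℝ, wedge u w ≠ 0 → Adm (interior K) u w → 1 ≤ |wedge u w|)
    (hu : ((1 : ℝ), (0 : ℝ)) ∈ K) :
    ∃ x : ℝ, (x, 1) ∈ K ∧ (x - 1, 1) ∈ K ∧ Adm (interior K) (1, 0) (x, 1) := by
  obtain ⟨a, h1, h2⟩ := exists_chord hK hadm hmin hu
  refine ⟨a + 1, h2, by simpa using h1, ?_⟩
  intro m n hmn hx
  by_cases ha : ∃ k : ℤ, a = k
  · obtain ⟨k, rfl⟩ := ha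
    refine hadm (m + n * (k + 1)) n ?_ ?_
    · by_cases hn : n = 0
      · subst hn; simpa using hmn
      · exact Or.inr hn
    · convert hx using 1
      ext <;> simp
  · push Not at ha
    have hk1 : a < (⌊a⌋ + 1 : ℤ) := by push_cast; exact Int.lt_floor_add_one a
    have hk2 : ((⌊a⌋ + 1 : ℤ) : ℝ) < a + 1 := by
      push_cast
      have := lt_of_le_of_ne (Int.floor_le a) (Ne.symm (ha _))
      linarith
    have hk : (((⌊a⌋ + 1 : ℤ) : ℝ), (1 : ℝ)) ∉ interior K := by
      simpa using hadm (⌊a⌋ + 1) 1 (by simp)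
    obtain ⟨σ, ρ, hs, he⟩ := exists_supp_of_notMem_interior hK hk
    have e1 := hs _ h1
    have e2 := hs _ h2
    simp only at e1 e2 he
    obtain rfl : σ = 0 := by
      apply le_antisymm
      · by_contra hc
        push Not at hc
        nlinarith
      · by_contra hc
        push Not at hc
        nlinarith
    obtain rfl : ρ = 1 := by linarith
    by_cases hn : n = 0
    · subst hn
      exact hadm m 0 hmn (by simpa using hx)
    · have e3 := hs.lt_one hx
      have e4 := hs.lt_one (hK.neg_mem_interior hx)
      simp at e3 e4
      have e5 : n < 1 := by exact_mod_cast e3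
      have e6 : -n < 1 := by
        have : -(n : ℝ) < 1 := by linarith
        exact_mod_cast this
      omega

lemma Crit.exists_boundary {K : Set (ℝ × ℝ)} {u w : ℝ × ℝ} (h : Crit K u w) (hu : u ∈ K) :
    ∃ w', Crit K w' (u - w') ∧ w' ∈ K ∧ u - w' ∈ K := by
  set T := latEquiv u w h.2.1 with hT
  have hu' : ((1 : ℝ), (0 : ℝ)) ∈ T ⁻¹' K := by simpa [hT, latEquiv_apply] using hu
  obtain ⟨x, h1, h2, h3⟩ := exists_adm_boundary (h.1.preimage T) h.adm_preimage_basis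
    h.minimal_preimage hu'
  have hT1 : T (x, 1) = x • u + w := by simp [hT, latEquiv_apply]
  have hT2 : T (x - 1, 1) = -(u - (x • u + w)) := by simp [hT, latEquiv_apply]; module
  have hT3 : T (1, 0) = u := by simp [hT, latEquiv_apply]
  rw [adm_preimage, hT3, hT1] at h3
  rw [Set.mem_preimage, hT1] at h1
  rw [Set.mem_preimage, hT2] at h2
  have hwe : wedge (x • u + w) (u - (x • u + w)) = -wedge u w := by
    simp [wedge]; ring
  refine ⟨x • u + w, ⟨h.1, ?_, ?_, ?_⟩, h1, by simpa using h.1.neg_mem h2⟩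
  · rw [hwe]; exact neg_ne_zero.2 h.2.1
  · intro m n hmn hx
    refine h3 n (m - n) (by omega) ?_
    convert hx using 1
    push_cast
    module
  · intro u' w' hne hadm
    rw [hwe, abs_neg]
    exact h.2.2.2 u' w' hne hadm

/-- If a vertex of an optimal lattice is a corner of `K`, then `K` is a parallelogram. -/
lemma Crit.parallelogram {K : Set (ℝ × ℝ)} {u w : ℝ × ℝ} (h : Crit K u w) (hu : u ∈ K)
    {a₁ b₁ a₂ b₂ : ℝ} (h₁ : Supp K a₁ b₁) (h₂ : Supp K a₂ b₂)
    (hu₁ : a₁ * u.1 + b₁ * u.2 = 1) (hu₂ : a₂ * u.1 + b₂ * u.2 = 1)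
    (hne : a₁ ≠ a₂ ∨ b₁ ≠ b₂) :
    ∃ v z, ∃ hvz : wedge v z ≠ 0, Crit K v z ∧
      ∀ x, latEquiv v z hvz x ∈ K ↔ |x.1| ≤ 1 ∧ |x.2| ≤ 1 := by
  obtain ⟨v, hc, hv, hz⟩ := h.exists_boundary hu
  refine ⟨v, u - v, hc.2.1, hc, ?_⟩
  have hwe := hc.2.1
  have supp : ∀ {a b : ℝ}, Supp K a b → a * u.1 + b * u.2 = 1 →
      Supp (latEquiv v (u - v) hwe ⁻¹' K) (a * v.1 + b * v.2) (1 - (a * v.1 + b * v.2)) := by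
    intro a b hs he x hx
    have := hs _ hx
    simp only [latEquiv_apply, Prod.fst_add, Prod.snd_add, Prod.smul_fst, Prod.smul_snd,
      Prod.fst_sub, Prod.snd_sub, smul_eq_mul] at this
    have e : (1 - (a * v.1 + b * v.2)) * x.2
      = (a * u.1 + b * u.2) * x.2 - (a * v.1 + b * v.2) * x.2 := by rw [he]; ring
    rw [e]
    linarith
  have hq : a₁ * v.1 + b₁ * v.2 ≠ a₂ * v.1 + b₂ * v.2 := by
    intro hq
    have e1 : (a₁ - a₂) * wedge v (u - v) = 0 := by
      simp only [wedge, Prod.fst_sub, Prod.snd_sub]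
      linear_combination u.2 * hq - v.2 * (hu₁ - hu₂)
    have e2 : (b₁ - b₂) * wedge v (u - v) = 0 := by
      simp only [wedge, Prod.fst_sub, Prod.snd_sub]
      linear_combination -u.1 * hq + v.1 * (hu₁ - hu₂)
    have e3 := (mul_eq_zero.1 e1).resolve_right hwe
    have e4 := (mul_eq_zero.1 e2).resolve_right hwe
    rcases hne with hne | hne
    · exact hne (by linarith)
    · exact hne (by linarith)
  have m1 : ((1 : ℝ), (0 : ℝ)) ∈ latEquiv v (u - v) hwe ⁻¹' K := by
    simpa [latEquiv_apply] using hv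
  have m2 : ((0 : ℝ), (1 : ℝ)) ∈ latEquiv v (u - v) hwe ⁻¹' K := by
    simpa [latEquiv_apply] using hz
  have m3 : ((1 : ℝ), (1 : ℝ)) ∈ latEquiv v (u - v) hwe ⁻¹' K := by
    simpa [latEquiv_apply] using hu
  rcases lt_or_gt_of_ne hq with hq | hq
  · exact eq_square_of_corner (hc.1.preimage _) hc.adm_preimage_basis hc.minimal_preimage
      m1 m2 m3 hq (supp h₁ hu₁) (supp h₂ hu₂)
  · exact eq_square_of_corner (hc.1.preimage _) hc.adm_preimage_basis hc.minimal_preimage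
      m1 m2 m3 hq (supp h₂ hu₂) (supp h₁ hu₁)

lemma det_latEquiv (u w : ℝ × ℝ) (h : wedge u w ≠ 0) :
    LinearMap.det ((latEquiv u w h : (ℝ × ℝ) ≃L[ℝ] (ℝ × ℝ)) : (ℝ × ℝ) →ₗ[ℝ] (ℝ × ℝ))
      = wedge u w := by
  rw [← LinearMap.det_toMatrix (Module.Basis.finTwoProd ℝ), Matrix.det_fin_two]
  simp [LinearMap.toMatrix_apply, latEquiv_apply, wedge]
  ring

lemma volume_eq_mul_volume_preimage (u w : ℝ × ℝ) (h : wedge u w ≠ 0) (K : Set (ℝ × ℝ)) :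
    (volume K).toReal = |wedge u w| * (volume (latEquiv u w h ⁻¹' K)).toReal := by
  conv_lhs => rw [← (latEquiv u w h).surjective.image_preimage K]
  rw [Measure.addHaar_image_continuousLinearEquiv, det_latEquiv, ENNReal.toReal_mul,
    ENNReal.toReal_ofReal (abs_nonneg _)]

lemma IsCSCD.volume_interior {K : Set (ℝ × ℝ)} (hK : IsCSCD K) :
    volume (interior K) = volume K :=
  measure_congr (interior_ae_eq_of_null_frontier (hK.1.addHaar_frontier volume))

lemma volume_fundamentalDomain_finTwoProd :
    volume (ZSpan.fundamentalDomain (Module.Basis.finTwoProd ℝ)) = 1 := by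
  have : ZSpan.fundamentalDomain (Module.Basis.finTwoProd ℝ)
      = Set.Ico (0 : ℝ) 1 ×ˢ Set.Ico (0 : ℝ) 1 := by
    ext x
    simp [ZSpan.mem_fundamentalDomain, Fin.forall_fin_two]
  rw [this, Measure.volume_eq_prod, Measure.prod_prod]
  simp

/-- Minkowski's theorem for admissible lattices. -/
lemma volume_le_of_adm {K : Set (ℝ × ℝ)} (hK : IsCSCD K) {u w : ℝ × ℝ} (h : wedge u w ≠ 0)
    (hadm : Adm (interior K) u w) : (volume K).toReal ≤ 4 * |wedge u w| := by
  rw [volume_eq_mul_volume_preimage u w h, mul_comm]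
  refine mul_le_mul_of_nonneg_right ?_ (abs_nonneg _)
  set T := latEquiv u w h with hT
  have hK' := hK.preimage T
  have hadm' : Adm (interior (T ⁻¹' K)) (1, 0) (0, 1) := by
    rw [adm_preimage]
    simpa [hT, latEquiv_apply] using hadm
  rw [← hK'.volume_interior]
  by_contra hc
  push Not at hc
  have hfin : volume (interior (T ⁻¹' K)) ≠ ⊤ := by
    rw [hK'.volume_interior]; exact hK'.2.1.measure_ne_top
  have hlt : volume (ZSpan.fundamentalDomain (Module.Basis.finTwoProd ℝ))
      * 2 ^ Module.finrank ℝ (ℝ × ℝ) < volume (interior (T ⁻¹' K)) := by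
    rw [volume_fundamentalDomain_finTwoProd, ← ENNReal.toReal_lt_toReal (by finiteness) hfin]
    simp only [one_mul, Module.finrank_prod, Module.finrank_self, ENNReal.toReal_pow,
      ENNReal.toReal_ofNat]
    norm_num
    exact hc
  have : Countable (Submodule.span ℤ (Set.range (Module.Basis.finTwoProd ℝ))).toAddSubgroup :=
    inferInstanceAs (Countable (Submodule.span ℤ (Set.range (Module.Basis.finTwoProd ℝ))))
  obtain ⟨⟨x, hxL⟩, hx0, hx⟩ := exists_ne_zero_mem_lattice_of_measure_mul_two_pow_lt_measure
    (ZSpan.isAddFundamentalDomain' (Module.Basis.finTwoProd ℝ) volume)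
    (fun x => hK'.neg_mem_interior) hK'.1.interior hlt
  have hx2 := ((Module.Basis.finTwoProd ℝ).mem_span_iff_repr_mem ℤ x).1 hxL
  obtain ⟨m, hm⟩ := hx2 0
  obtain ⟨n, hn⟩ := hx2 1
  simp at hm hn
  refine hadm' m n ?_ ?_
  · by_contra hmn
    push Not at hmn
    obtain ⟨rfl, rfl⟩ := hmn
    apply hx0
    ext <;> simp [← hm, ← hn]
  · convert hx using 1
    ext <;> simp [hm, hn]

lemma eq_zero_of_smul_add_smul {u w : ℝ × ℝ} (h : wedge u w ≠ 0) {m n : ℝ}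
    (e : m • u + n • w = 0) : m = 0 ∧ n = 0 := by
  have := (latEquiv u w h).injective (a₁ := (m, n)) (a₂ := 0) (by simpa [latEquiv_apply] using e)
  simpa using this

lemma interior_add_image (K : Set (ℝ × ℝ)) (p : ℝ × ℝ) :
    interior ((fun x => p + x) '' K) = (fun x => p + x) '' interior K :=
  ((Homeomorph.addLeft p).image_interior K).symm

lemma isPacking_iff_adm {K : Set (ℝ × ℝ)} (hK : IsCSCD K) {u w : ℝ × ℝ} (h : wedge u w ≠ 0) :
    IsPacking K (latticeOf ((2 : ℝ) • u) ((2 : ℝ) • w)) ↔ Adm (interior K) u w := by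
  constructor
  · intro hp m n hmn hx
    have h0 : (0 : ℝ × ℝ) ∈ latticeOf ((2 : ℝ) • u) ((2 : ℝ) • w) := ⟨0, 0, by simp⟩
    have h1 : (m : ℝ) • (2 : ℝ) • u + (n : ℝ) • (2 : ℝ) • w
      ∈ latticeOf ((2 : ℝ) • u) ((2 : ℝ) • w) := ⟨m, n, rfl⟩
    have hne : (0 : ℝ × ℝ) ≠ (m : ℝ) • (2 : ℝ) • u + (n : ℝ) • (2 : ℝ) • w := by
      intro he
      have e : ((m : ℝ) * 2) • u + ((n : ℝ) * 2) • w = 0 := by rw [he]; module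
      have := eq_zero_of_smul_add_smul h e
      simp at this
      omega
    have := hp _ h0 _ h1 hne
    rw [interior_add_image, interior_add_image] at this
    refine Set.eq_empty_iff_forall_notMem.1 this ((m : ℝ) • u + (n : ℝ) • w) ⟨⟨_, hx, by simp⟩, ?_⟩
    exact ⟨_, hK.neg_mem_interior hx, by dsimp only; module⟩
  · rintro ha _ ⟨m, n, rfl⟩ _ ⟨m', n', rfl⟩ hne
    rw [interior_add_image, interior_add_image, Set.eq_empty_iff_forall_notMem]
    rintro _ ⟨⟨x, hx, rfl⟩, ⟨y, hy, he⟩⟩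
    refine ha (m - m') (n - n') ?_ ?_
    · by_contra hc
      push Not at hc
      obtain rfl : m = m' := by omega
      obtain rfl : n = n' := by omega
      exact hne rfl
    · have := hK.1.interior hy (hK.neg_mem_interior hx) (a := 1 / 2) (b := 1 / 2)
        (by norm_num) (by norm_num) (by norm_num)
      convert this using 1
      dsimp only at he
      have e2 : y = (m : ℝ) • (2 : ℝ) • u + (n : ℝ) • (2 : ℝ) • w + x
        - ((m' : ℝ) • (2 : ℝ) • u + (n' : ℝ) • (2 : ℝ) • w) := by rw [← he]; abel
      rw [e2]
      push_cast
      module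

lemma mem_packingDensities_iff {K : Set (ℝ × ℝ)} (hK : IsCSCD K) (d : ℝ) :
    d ∈ packingDensities K ↔ ∃ u w, wedge u w ≠ 0 ∧ Adm (interior K) u w ∧
      d = (volume K).toReal / (4 * |wedge u w|) := by
  have hw : ∀ u w : ℝ × ℝ, wedge ((2 : ℝ) • u) ((2 : ℝ) • w) = 4 * wedge u w := fun u w => by
    simp [wedge]; ring
  constructor
  · rintro ⟨v, w, hne, hp, rfl⟩
    obtain ⟨v, rfl⟩ : ∃ v', v = (2 : ℝ) • v' := ⟨(1 / 2 : ℝ) • v, by module⟩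
    obtain ⟨w, rfl⟩ : ∃ w', w = (2 : ℝ) • w' := ⟨(1 / 2 : ℝ) • w, by module⟩
    rw [hw] at hne
    have hne' := right_ne_zero_of_mul hne
    exact ⟨v, w, hne', (isPacking_iff_adm hK hne').1 hp, by
      rw [hw, abs_mul, abs_of_pos (four_pos : (0 : ℝ) < 4)]⟩
  · rintro ⟨u, w, hne, ha, rfl⟩
    exact ⟨(2 : ℝ) • u, (2 : ℝ) • w, by rw [hw]; exact mul_ne_zero four_ne_zero hne,
      (isPacking_iff_adm hK hne).2 ha, by rw [hw, abs_mul, abs_of_pos (four_pos : (0 : ℝ) < 4)]⟩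

lemma packingDensities_le_one {K : Set (ℝ × ℝ)} (hK : IsCSCD K) :
    ∀ d ∈ packingDensities K, d ≤ 1 := by
  intro d hd
  obtain ⟨u, w, hne, ha, rfl⟩ := (mem_packingDensities_iff hK d).1 hd
  have := abs_pos.2 hne
  rw [div_le_one (by linarith)]
  exact volume_le_of_adm hK hne ha

lemma deltaLat_le_one {K : Set (ℝ × ℝ)} (hK : IsCSCD K) : deltaLat K ≤ 1 :=
  Real.sSup_le (packingDensities_le_one hK) zero_le_one

lemma le_deltaLat {K : Set (ℝ × ℝ)} (hK : IsCSCD K) {u w : ℝ × ℝ} (h : wedge u w ≠ 0)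
    (ha : Adm (interior K) u w) : (volume K).toReal / (4 * |wedge u w|) ≤ deltaLat K :=
  le_csSup ⟨1, packingDensities_le_one hK⟩ ((mem_packingDensities_iff hK _).2 ⟨u, w, h, ha, rfl⟩)

lemma IsCSCD.volume_pos {K : Set (ℝ × ℝ)} (hK : IsCSCD K) : 0 < (volume K).toReal :=
  ENNReal.toReal_pos ((isOpen_interior.measure_pos volume hK.2.2.1).trans_le
    (measure_mono interior_subset)).ne' hK.2.1.measure_ne_top

lemma deltaLat_pos {K : Set (ℝ × ℝ)} (hK : IsCSCD K) : 0 < deltaLat K := by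
  obtain ⟨R, hR0, hR⟩ := hK.2.1.isBounded.exists_pos_norm_le
  have hs : ∀ a b : ℝ, |a| + |b| ≤ 1 → Supp K (a / R) (b / R) := by
    intro a b hab x hx
    have h1 := hR x hx
    have h2 : |x.1| ≤ R := (norm_fst_le x).trans h1
    have h3 : |x.2| ≤ R := (norm_snd_le x).trans h1
    rw [div_mul_eq_mul_div, div_mul_eq_mul_div, ← add_div, div_le_one hR0]
    calc a * x.1 + b * x.2 ≤ |a * x.1| + |b * x.2| := add_le_add (le_abs_self _) (le_abs_self _)
      _ = |a| * |x.1| + |b| * |x.2| := by rw [abs_mul, abs_mul]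
      _ ≤ |a| * R + |b| * R := by gcongr
      _ = (|a| + |b|) * R := by ring
      _ ≤ R := by nlinarith
  have h1 := hs 1 0 (by simp)
  have h2 := hs 0 1 (by simp)
  have ha : Adm (interior K) (R, 0) (0, R) := by
    refine adm_of_supp hK h1 h1 h2 ?_ ?_ ?_ ?_ ?_ ?_ <;> simp [hR0.ne']
  have hwe : wedge (R, 0) (0, R) = R * R := by simp [wedge]
  refine lt_of_lt_of_le ?_ (le_deltaLat hK (by rw [hwe]; positivity) ha)
  have := hK.volume_pos
  rw [hwe]
  positivity
lemma Adm.mono {U V : Set (ℝ × ℝ)} {u w : ℝ × ℝ} (h : Adm U u w) (hV : V ⊆ U) : Adm V u w :=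
  fun m n hmn hx => h m n hmn (hV hx)

/-- A primitive vector `x` of an admissible lattice is completed to a basis by a vector whose
component along `x` is at most half of `x`. -/
lemma Adm.exists_reduced_basis {U : Set (ℝ × ℝ)} {u w : ℝ × ℝ} (h : Adm U u w) {m n : ℤ}
    (hmn : IsCoprime m n) {x : ℝ × ℝ} (hx : x = (m : ℝ) • u + (n : ℝ) • w) (hx0 : x ≠ 0) :
    ∃ α : ℝ, |α| ≤ 1 / 2 ∧
      Adm U x (α • x + (wedge u w / (x.1 ^ 2 + x.2 ^ 2)) • (-x.2, x.1)) := by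
  obtain ⟨s, t, hst⟩ := hmn
  have hst' : (s : ℝ) * m + t * n = 1 := by exact_mod_cast hst
  have hN : x.1 ^ 2 + x.2 ^ 2 ≠ 0 := by
    intro h0
    apply hx0
    ext
    · exact pow_eq_zero_iff two_ne_zero |>.1 (by nlinarith [sq_nonneg x.1, sq_nonneg x.2])
    · exact pow_eq_zero_iff two_ne_zero |>.1 (by nlinarith [sq_nonneg x.1, sq_nonneg x.2])
  set z : ℝ × ℝ := (-t : ℝ) • u + (s : ℝ) • w with hz
  set β : ℝ := (z.1 * x.1 + z.2 * x.2) / (x.1 ^ 2 + x.2 ^ 2) with hβ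
  have hD : wedge x z = wedge u w := by
    rw [hx, hz]
    simp only [wedge, Prod.fst_add, Prod.snd_add, Prod.smul_fst, Prod.smul_snd, smul_eq_mul]
    linear_combination (u.1 * w.2 - u.2 * w.1) * hst'
  have hdec : z = β • x + (wedge u w / (x.1 ^ 2 + x.2 ^ 2)) • (-x.2, x.1) := by
    rw [← hD, hβ]
    ext
    · simp only [wedge, Prod.fst_add, Prod.smul_fst, smul_eq_mul]
      field_simp
      ring
    · simp only [wedge, Prod.snd_add, Prod.smul_snd, smul_eq_mul]
      field_simp
      ring
  refine ⟨β - round β, abs_sub_round β, fun i j hij hU => ?_⟩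
  refine h (i * m + j * (-t - round β * m)) (i * n + j * (s - round β * n)) ?_ ?_
  · by_contra! hc
    obtain ⟨h1, h2⟩ := hc
    have hj : j = 0 := by linear_combination -n * h1 + m * h2 - j * hst
    have hi : i = 0 := by
      subst hj
      linear_combination s * h1 + t * h2 - i * hst
    omega
  · convert hU using 1
    have : (β - round β) • x + (wedge u w / (x.1 ^ 2 + x.2 ^ 2)) • (-x.2, x.1)
        = z - (round β : ℝ) • x := by
      rw [hdec]; module
    rw [this, hz, hx]
    push_cast
    module

/-- The part of `K` between the lines where the functional with coefficients `a`, `b` takes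
the values `-c` and `c`. -/
def strip (K : Set (ℝ × ℝ)) (a b c : ℝ) : Set (ℝ × ℝ) :=
  K ∩ {x | |a * x.1 + b * x.2| ≤ c}

lemma interior_inter_subset_interior_strip (K : Set (ℝ × ℝ)) (a b c : ℝ) :
    interior K ∩ {x | |a * x.1 + b * x.2| < c} ⊆ interior (strip K a b c) := by
  refine interior_maximal ?_ ?_
  · rintro x ⟨h1, h2⟩
    have h3 : |a * x.1 + b * x.2| < c := h2
    exact ⟨interior_subset h1, h3.le⟩
  · exact isOpen_interior.inter (isOpen_lt (by fun_prop) continuous_const)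

lemma IsCSCD.strip {K : Set (ℝ × ℝ)} (hK : IsCSCD K) {a b c : ℝ} (hc : 0 < c) :
    IsCSCD (strip K a b c) := by
  refine ⟨hK.1.inter ?_, hK.2.1.inter_right (isClosed_le (by fun_prop) continuous_const), ?_, ?_⟩
  · intro x hx y hy s t hs ht hst
    simp only [Set.mem_ofPred_eq, abs_le, Prod.fst_add, Prod.snd_add, Prod.smul_fst,
      Prod.smul_snd, smul_eq_mul] at hx hy ⊢
    constructor <;> nlinarith
  · exact ⟨0, interior_inter_subset_interior_strip K a b c ⟨hK.zero_mem_interior, by simpa⟩⟩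
  · have h : ∀ x ∈ _root_.strip K a b c, -x ∈ _root_.strip K a b c := fun x hx =>
      ⟨hK.neg_mem hx.1, by
        have := hx.2
        simp only [Set.mem_ofPred_eq, Prod.fst_neg, Prod.snd_neg] at this ⊢
        rw [← abs_neg]
        convert this using 2
        ring⟩
    ext x
    exact ⟨fun hx => h x hx, fun hx => by simpa using h _ hx⟩

lemma volume_strip_lt {K : Set (ℝ × ℝ)} (hK : IsCSCD K) {a b c : ℝ} (hc : 0 < c) (hc1 : c < 1)
    {p : ℝ × ℝ} (hp : p ∈ K) (hfp : a * p.1 + b * p.2 = 1) :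
    (volume (strip K a b c)).toReal < (volume K).toReal := by
  set V : Set (ℝ × ℝ) := interior K ∩ {x | c < a * x.1 + b * x.2}
  have hV : IsOpen V := isOpen_interior.inter (isOpen_lt continuous_const (by fun_prop))
  have hVne : V.Nonempty := by
    refine ⟨((1 + c) / 2) • p, hK.smul_mem_interior hp ?_, ?_⟩
    · rw [abs_of_pos (by linarith)]; linarith
    · simp only [Set.mem_ofPred_eq, Prod.smul_fst, Prod.smul_snd, smul_eq_mul]
      nlinarith
  have hVfin : volume V ≠ ⊤ :=
    measure_ne_top_of_subset (Set.inter_subset_left.trans interior_subset) hK.2.1.measure_ne_top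
  have hSfin : volume (strip K a b c) ≠ ⊤ := (hK.strip hc).2.1.measure_ne_top
  have hdisj : Disjoint (strip K a b c) V := by
    rw [Set.disjoint_left]
    rintro x ⟨-, h1⟩ ⟨-, h2⟩
    have h3 : |a * x.1 + b * x.2| ≤ c := h1
    have h4 : c < a * x.1 + b * x.2 := h2
    linarith [le_abs_self (a * x.1 + b * x.2)]
  have hle : volume (strip K a b c) + volume V ≤ volume K := by
    rw [← measure_union hdisj hV.measurableSet]
    exact measure_mono (Set.union_subset Set.inter_subset_left
      (Set.inter_subset_left.trans interior_subset))
  have h1 := ENNReal.toReal_mono hK.2.1.measure_ne_top hle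
  rw [ENNReal.toReal_add hSfin hVfin] at h1
  have h2 := ENNReal.toReal_pos (hV.measure_pos volume hVne).ne' hVfin
  linarith

/-- Truncating a miserly domain leads to a lattice denser than allowed, so that one of its points
lies in the part cut off. -/
lemma IsMiserly.exists_adm_strip {K : Set (ℝ × ℝ)} (hK : IsMiserly K) {a b c : ℝ}
    (hc : 1 / 2 < c) (hc1 : c < 1) (hs : Supp K a b) {p : ℝ × ℝ} (hp : p ∈ K)
    (hfp : a * p.1 + b * p.2 = 1) :
    ∃ (x : ℝ × ℝ) (α D : ℝ), x ∈ interior K ∧ c ≤ a * x.1 + b * x.2 ∧ |α| ≤ 1 / 2 ∧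
      |D| ≤ (volume K).toReal / (4 * deltaLat K) ∧
      Adm (interior K ∩ {x | |a * x.1 + b * x.2| < c}) x
        (α • x + (D / (x.1 ^ 2 + x.2 ^ 2)) • (-x.2, x.1)) := by
  have hC := hK.1
  have hc0 : 0 < c := by linarith
  have hV := hC.volume_pos
  have hδ := deltaLat_pos hC
  have hS := hC.strip (a := a) (b := b) hc0
  have hlt := volume_strip_lt hC hc0 hc1 hp hfp
  set V := (volume K).toReal
  set Vs := (volume (strip K a b c)).toReal
  set δ := deltaLat K
  have h1 : Vs / V * δ < deltaLat (strip K a b c) :=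
    lt_of_lt_of_le (mul_lt_of_lt_one_left hδ ((div_lt_one hV).2 hlt)) (hK.2 _ hS)
  have hne : (packingDensities (strip K a b c)).Nonempty := by
    by_contra hne
    have := deltaLat_pos hS
    rw [deltaLat, Set.not_nonempty_iff_eq_empty.1 hne, Real.sSup_empty] at this
    exact lt_irrefl _ this
  obtain ⟨d, hd, hlt'⟩ := exists_lt_of_lt_csSup hne h1
  obtain ⟨u, w, huw, hadm, rfl⟩ := (mem_packingDensities_iff hS d).1 hd
  have huw' := abs_pos.2 huw
  have hVs : 0 < Vs := hS.volume_pos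
  have hD : |wedge u w| < V / (4 * δ) := by
    rw [div_mul_eq_mul_div, div_lt_div_iff₀ hV (by positivity)] at hlt'
    rw [lt_div_iff₀ (by positivity)]
    refine lt_of_mul_lt_mul_left ?_ hVs.le
    linarith
  have hnot : ¬ Adm (interior K) u w := fun h => by
    have := le_deltaLat hC huw h
    rw [div_le_iff₀ (by positivity)] at this
    rw [lt_div_iff₀ (by positivity)] at hD
    nlinarith
  have hadm' := hadm.mono (interior_inter_subset_interior_strip K a b c)
  simp only [Adm, not_forall, not_not] at hnot
  obtain ⟨m, n, hmn, hx⟩ := hnot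
  wlog hpos : 0 ≤ a * ((m : ℝ) • u + (n : ℝ) • w).1 + b * ((m : ℝ) • u + (n : ℝ) • w).2
    generalizing m n
  · refine this (-m) (-n) (by omega) ?_ ?_
    · convert hC.neg_mem_interior hx using 1
      push_cast
      module
    · simp only [Prod.fst_add, Prod.snd_add, Prod.smul_fst, Prod.smul_snd, smul_eq_mul,
        Int.cast_neg] at hpos ⊢
      linarith
  set x : ℝ × ℝ := (m : ℝ) • u + (n : ℝ) • w with hxdef
  have hcx : c ≤ a * x.1 + b * x.2 := by
    by_contra! hlt
    refine hadm' m n hmn ⟨hx, ?_⟩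
    rwa [Set.mem_ofPred_eq, abs_of_nonneg hpos]
  have hx0 : x ≠ 0 := by
    intro h0
    rw [h0] at hcx
    simp at hcx
    linarith
  have hcop : IsCoprime m n := by
    have hg0 : Int.gcd m n ≠ 0 := by
      rw [Ne, Int.gcd_eq_zero_iff]; omega
    rw [Int.isCoprime_iff_gcd_eq_one]
    by_contra hg1
    obtain ⟨m', hm'⟩ := Int.gcd_dvd_left (a := m) (b := n)
    obtain ⟨n', hn'⟩ := Int.gcd_dvd_right (a := m) (b := n)
    set g := Int.gcd m n
    have hg2 : (2 : ℝ) ≤ g := by exact_mod_cast (by omega : 2 ≤ g)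
    have hxg : (m' : ℝ) • u + (n' : ℝ) • w = (g : ℝ)⁻¹ • x := by
      rw [hxdef, hm', hn']
      push_cast
      rw [smul_add, smul_smul, smul_smul, inv_mul_cancel_left₀ (by positivity),
        inv_mul_cancel_left₀ (by positivity)]
    have hginv : (g : ℝ)⁻¹ ≤ 1 / 2 := by
      rw [one_div]; exact inv_anti₀ two_pos hg2
    have hginv0 : 0 < (g : ℝ)⁻¹ := by positivity
    refine hadm' m' n' ?_ (hxg ▸ ⟨hC.smul_mem_interior (interior_subset hx) ?_, ?_⟩)
    · by_contra! hc
      rw [hc.1, mul_zero] at hm'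
      rw [hc.2, mul_zero] at hn'
      omega
    · rw [abs_of_pos hginv0]; linarith
    · simp only [Set.mem_ofPred_eq, Prod.smul_fst, Prod.smul_snd, smul_eq_mul]
      have hlt1 := hs.lt_one hx
      rw [show a * ((g : ℝ)⁻¹ * x.1) + b * ((g : ℝ)⁻¹ * x.2)
        = (g : ℝ)⁻¹ * (a * x.1 + b * x.2) by ring, abs_of_nonneg (by positivity)]
      nlinarith
  obtain ⟨α, hα, hA⟩ := hadm'.exists_reduced_basis hcop hxdef hx0
  exact ⟨x, α, wedge u w, hx, hcx, hα, hD.le, hA⟩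

/-- Every corner of a miserly domain belongs to a critical lattice. -/
lemma IsMiserly.exists_crit {K : Set (ℝ × ℝ)} (hK : IsMiserly K) {p : ℝ × ℝ} (hp : p ∈ K)
    {a₁ b₁ a₂ b₂ : ℝ} (h₁ : Supp K a₁ b₁) (h₂ : Supp K a₂ b₂)
    (hp₁ : a₁ * p.1 + b₁ * p.2 = 1) (hp₂ : a₂ * p.1 + b₂ * p.2 = 1)
    (hne : a₁ ≠ a₂ ∨ b₁ ≠ b₂) : ∃ w, Crit K p w := by
  have hC := hK.1
  have hd : a₁ * b₂ - a₂ * b₁ ≠ 0 := by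
    intro h0
    have e1 : a₁ = a₂ := by linear_combination (-a₁) * hp₂ + a₂ * hp₁ + p.2 * h0
    have e2 : b₁ = b₂ := by linear_combination (-b₁) * hp₂ + b₂ * hp₁ - p.1 * h0
    tauto
  have hp0 : p.1 ^ 2 + p.2 ^ 2 ≠ 0 := by
    intro h0
    have e1 : p.1 = 0 := pow_eq_zero_iff two_ne_zero |>.1 (by
      nlinarith [sq_nonneg p.1, sq_nonneg p.2])
    have e2 : p.2 = 0 := pow_eq_zero_iff two_ne_zero |>.1 (by
      nlinarith [sq_nonneg p.1, sq_nonneg p.2])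
    rw [e1, e2] at hp₁
    simp at hp₁
  set a := (a₁ + a₂) / 2 with ha
  set b := (b₁ + b₂) / 2 with hb
  have hs : Supp K a b := fun x hx => by
    have := h₁ x hx
    have := h₂ x hx
    rw [ha, hb]
    linarith
  have hfp : a * p.1 + b * p.2 = 1 := by rw [ha, hb]; linarith
  set Δ := (volume K).toReal / (4 * deltaLat K) with hΔ
  have hδ := deltaLat_pos hC
  obtain ⟨c, hc, hc0, hc1⟩ : ∃ c : ℕ → ℝ, Filter.Tendsto c Filter.atTop (nhds 1) ∧
      (∀ n, 1 / 2 < c n) ∧ ∀ n, c n < 1 := by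
    refine ⟨fun n => 1 - 1 / 3 * (1 / ((n : ℝ) + 1)), ?_, fun n => ?_, fun n => ?_⟩
    · simpa using (tendsto_one_div_add_atTop_nhds_zero_nat.const_mul (1 / 3 : ℝ)).const_sub 1
    · have : (1 : ℝ) / ((n : ℝ) + 1) ≤ 1 := by
        rw [div_le_one (by positivity)]
        linarith [n.cast_nonneg (α := ℝ)]
      simp only
      linarith
    · have : 0 < (1 : ℝ) / ((n : ℝ) + 1) := by positivity
      simp only
      linarith
  have H := fun n => hK.exists_adm_strip (hc0 n) (hc1 n) hs hp hfp
  choose x α D hxK hxc hα hD hA using H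
  have hc2 : Filter.Tendsto (fun n => 2 * c n - 1) Filter.atTop (nhds 1) := by
    have := (hc.const_mul 2).sub_const 1
    norm_num at this
    exact this
  have hx₁ : Filter.Tendsto (fun n => a₁ * (x n).1 + b₁ * (x n).2) Filter.atTop (nhds 1) := by
    refine tendsto_of_tendsto_of_tendsto_of_le_of_le hc2 tendsto_const_nhds (fun n => ?_)
      (fun n => h₁ _ (interior_subset (hxK n)))
    have := h₂ _ (interior_subset (hxK n))
    have := hxc n
    rw [ha, hb] at this
    simp only
    linarith
  have hx₂ : Filter.Tendsto (fun n => a₂ * (x n).1 + b₂ * (x n).2) Filter.atTop (nhds 1) := by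
    refine tendsto_of_tendsto_of_tendsto_of_le_of_le hc2 tendsto_const_nhds (fun n => ?_)
      (fun n => h₂ _ (interior_subset (hxK n)))
    have := h₁ _ (interior_subset (hxK n))
    have := hxc n
    rw [ha, hb] at this
    simp only
    linarith
  have hx : Filter.Tendsto x Filter.atTop (nhds p) := by
    have e1 := ((hx₁.const_mul b₂).sub (hx₂.const_mul b₁)).div_const (a₁ * b₂ - a₂ * b₁)
    have e2 := ((hx₂.const_mul a₁).sub (hx₁.const_mul a₂)).div_const (a₁ * b₂ - a₂ * b₁)
    convert e1.prodMk_nhds e2 using 1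
    · ext n
      · rw [eq_div_iff hd]
        ring
      · rw [eq_div_iff hd]
        ring
    · congr 1
      ext
      · rw [eq_div_iff hd]
        linear_combination b₂ * hp₁ - b₁ * hp₂
      · rw [eq_div_iff hd]
        linear_combination a₁ * hp₂ - a₂ * hp₁
  obtain ⟨⟨α', D'⟩, ⟨hα', hD'⟩, φ, hφ, hlim⟩ :=
    ((isCompact_Icc (a := (-(1 / 2) : ℝ)) (b := 1 / 2)).prod
      (isCompact_Icc (a := -Δ) (b := Δ))).tendsto_subseq
      (x := fun n => (α n, D n)) (fun n => ⟨abs_le.1 (hα n), abs_le.1 (hD n)⟩)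
  have hα'' : |α'| ≤ 1 / 2 := abs_le.2 hα'
  have hD'' : |D'| ≤ Δ := abs_le.2 hD'
  have hxφ := hx.comp hφ.tendsto_atTop
  have hcφ := hc.comp hφ.tendsto_atTop
  set w : ℝ × ℝ := α' • p + (D' / (p.1 ^ 2 + p.2 ^ 2)) • (-p.2, p.1) with hw
  have hlimα : Filter.Tendsto (fun n => α (φ n)) Filter.atTop (nhds α') :=
    (continuous_fst.tendsto _).comp hlim
  have hlimD : Filter.Tendsto (fun n => D (φ n)) Filter.atTop (nhds D') :=
    (continuous_snd.tendsto _).comp hlim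
  have hx1 : Filter.Tendsto (fun n => (x (φ n)).1) Filter.atTop (nhds p.1) :=
    (continuous_fst.tendsto _).comp hxφ
  have hx2 : Filter.Tendsto (fun n => (x (φ n)).2) Filter.atTop (nhds p.2) :=
    (continuous_snd.tendsto _).comp hxφ
  have hwlim : Filter.Tendsto (fun n => α (φ n) • x (φ n) +
      (D (φ n) / ((x (φ n)).1 ^ 2 + (x (φ n)).2 ^ 2)) • (-(x (φ n)).2, (x (φ n)).1))
      Filter.atTop (nhds w) :=
    (hlimα.smul hxφ).add ((hlimD.div ((hx1.pow 2).add (hx2.pow 2)) hp0).smul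
      (hx2.neg.prodMk_nhds hx1))
  have hadm : Adm (interior K) p w := by
    intro m n hmn hin
    set q := (m : ℝ) • p + (n : ℝ) • w with hq
    have hf1 : |a * q.1 + b * q.2| < 1 := by
      have e1 := hs.lt_one hin
      have e2 := hs.lt_one (hC.neg_mem_interior hin)
      simp only [Prod.fst_neg, Prod.snd_neg] at e2
      rw [abs_lt]
      constructor <;> linarith
    obtain ⟨c', hlo, hhi⟩ := exists_between hf1
    have hopen : IsOpen (interior K ∩ {x | |a * x.1 + b * x.2| < c'}) :=
      isOpen_interior.inter (isOpen_lt (by fun_prop) continuous_const)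
    have hev := ((hxφ.const_smul (m : ℝ)).add (hwlim.const_smul (n : ℝ))).eventually
      (hopen.mem_nhds ⟨hin, hlo⟩)
    obtain ⟨k, ⟨hk1, hk2⟩, hk3⟩ := (hev.and (hcφ.eventually (lt_mem_nhds hhi))).exists
    exact hA (φ k) m n hmn ⟨hk1, (show _ < c' from hk2).trans hk3⟩
  have hwedge : wedge p w = D' := by
    simp only [wedge, hw, Prod.fst_add, Prod.snd_add, Prod.smul_fst, Prod.smul_snd, smul_eq_mul]
    field_simp
    ring
  have hD0 : wedge p w ≠ 0 := by
    rw [hwedge]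
    intro h0
    refine hadm 0 1 (by simp) ?_
    have : w = α' • p := by rw [hw, h0]; simp
    rw [this]
    simpa using hC.smul_mem_interior hp (c := α') (by linarith)
  refine ⟨w, hC, hD0, hadm, fun u' w' huw' ha' => ?_⟩
  rw [hwedge]
  refine hD''.trans ?_
  have := le_deltaLat hC huw' ha'
  have hpos' := abs_pos.2 huw'
  rw [div_le_iff₀ (by positivity)] at this
  rw [hΔ, div_le_iff₀ (by positivity)]
  linarith

/-- A miserly domain with a corner is a parallelogram. -/
lemma IsMiserly.parallelogram {K : Set (ℝ × ℝ)} (hK : IsMiserly K) {p : ℝ × ℝ} (hp : p ∈ K)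
    {a₁ b₁ a₂ b₂ : ℝ} (h₁ : Supp K a₁ b₁) (h₂ : Supp K a₂ b₂)
    (hp₁ : a₁ * p.1 + b₁ * p.2 = 1) (hp₂ : a₂ * p.1 + b₂ * p.2 = 1)
    (hne : a₁ ≠ a₂ ∨ b₁ ≠ b₂) :
    ∃ v z, ∃ hvz : wedge v z ≠ 0, Crit K v z ∧
      ∀ x, latEquiv v z hvz x ∈ K ↔ |x.1| ≤ 1 ∧ |x.2| ≤ 1 := by
  obtain ⟨w, hw⟩ := hK.exists_crit hp h₁ h₂ hp₁ hp₂ hne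
  exact hw.parallelogram hp h₁ h₂ hp₁ hp₂ hne

lemma one_le_deltaLat_of_parallelogram {K : Set (ℝ × ℝ)} {v z : ℝ × ℝ} (hvz : wedge v z ≠ 0)
    (hc : Crit K v z) (h : ∀ x, latEquiv v z hvz x ∈ K ↔ |x.1| ≤ 1 ∧ |x.2| ≤ 1) :
    1 ≤ deltaLat K := by
  have hpre : latEquiv v z hvz ⁻¹' K = Set.Icc (-1 : ℝ) 1 ×ˢ Set.Icc (-1 : ℝ) 1 := by
    ext x
    simp only [Set.mem_preimage, h, Set.mem_prod, Set.mem_Icc, abs_le]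
  have hbox : (volume (Set.Icc (-1 : ℝ) 1 ×ˢ Set.Icc (-1 : ℝ) 1)).toReal = 4 := by
    rw [Measure.volume_eq_prod, Measure.prod_prod, Real.volume_Icc]
    norm_num
  have hvol := volume_eq_mul_volume_preimage v z hvz K
  rw [hpre, hbox] at hvol
  have := le_deltaLat hc.1 hvz hc.2.2.1
  have hpos := abs_pos.2 hvz
  rw [hvol, mul_comm, div_self (by positivity)] at this
  exact this

/-- An affinely regular hexagon. -/
def hexagon : Set (ℝ × ℝ) := {x | |x.1| ≤ 1 ∧ |x.2| ≤ 1 ∧ |x.1 - x.2| ≤ 1}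

lemma isCSCD_hexagon : IsCSCD hexagon := by
  refine ⟨?_, ?_, ?_, ?_⟩
  · intro x hx y hy s t hs ht hst
    simp only [hexagon, Set.mem_ofPred_eq, abs_le, Prod.fst_add, Prod.snd_add, Prod.smul_fst,
      Prod.smul_snd, smul_eq_mul] at hx hy ⊢
    refine ⟨⟨?_, ?_⟩, ⟨?_, ?_⟩, ⟨?_, ?_⟩⟩ <;> nlinarith
  · refine ((isCompact_Icc (a := (-1 : ℝ)) (b := 1)).prod
      (isCompact_Icc (a := (-1 : ℝ)) (b := 1))).of_isClosed_subset ?_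
      fun x hx => ⟨abs_le.1 hx.1, abs_le.1 hx.2.1⟩
    have h1 : IsClosed {x : ℝ × ℝ | |x.1| ≤ 1} := isClosed_le (by fun_prop) continuous_const
    have h2 : IsClosed {x : ℝ × ℝ | |x.2| ≤ 1} := isClosed_le (by fun_prop) continuous_const
    have h3 : IsClosed {x : ℝ × ℝ | |x.1 - x.2| ≤ 1} := isClosed_le (by fun_prop) continuous_const
    exact h1.and (h2.and h3)
  · have h1 : IsOpen {x : ℝ × ℝ | |x.1| < 1} := isOpen_lt (by fun_prop) continuous_const
    have h2 : IsOpen {x : ℝ × ℝ | |x.2| < 1} := isOpen_lt (by fun_prop) continuous_const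
    have h3 : IsOpen {x : ℝ × ℝ | |x.1 - x.2| < 1} := isOpen_lt (by fun_prop) continuous_const
    refine ⟨0, interior_maximal ?_ (h1.and (h2.and h3)) (by simp)⟩
    rintro x ⟨e1, e2, e3⟩
    exact ⟨e1.le, e2.le, e3.le⟩
  · ext x
    simp only [hexagon, Set.mem_neg, Set.mem_ofPred_eq, Prod.fst_neg, Prod.snd_neg, abs_neg]
    rw [show -x.1 - -x.2 = -(x.1 - x.2) by ring, abs_neg]

lemma hexagon_not_parallelogram {v z : ℝ × ℝ} (hvz : wedge v z ≠ 0)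
    (h : ∀ x, latEquiv v z hvz x ∈ hexagon ↔ |x.1| ≤ 1 ∧ |x.2| ≤ 1) : False := by
  have h' : ∀ y : ℝ × ℝ, y ∈ hexagon ↔
      |((latEquiv v z hvz).symm y).1| ≤ 1 ∧ |((latEquiv v z hvz).symm y).2| ≤ 1 := fun y => by
    rw [← h, ContinuousLinearEquiv.apply_symm_apply]
  set S := (latEquiv v z hvz).symm
  obtain ⟨a, b, hab⟩ : ∃ a b : ℝ, ∀ y, (S y).1 = a * y.1 + b * y.2 :=
    ⟨_, _, linear_apply ((LinearMap.fst ℝ ℝ ℝ).comp (S : (ℝ × ℝ) →ₗ[ℝ] ℝ × ℝ))⟩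
  obtain ⟨c, d, hcd⟩ : ∃ c d : ℝ, ∀ y, (S y).2 = c * y.1 + d * y.2 :=
    ⟨_, _, linear_apply ((LinearMap.snd ℝ ℝ ℝ).comp (S : (ℝ × ℝ) →ₗ[ℝ] ℝ × ℝ))⟩
  simp only [hab, hcd] at h'
  have hfr : ∀ y ∈ hexagon, (∀ t : ℝ, 1 < t → t • y ∉ hexagon) →
      1 ≤ |a * y.1 + b * y.2| ∨ 1 ≤ |c * y.1 + d * y.2| := by
    intro y hy hout
    by_contra! hlt
    obtain ⟨r, hr1, hr2⟩ := exists_between (max_lt hlt.1 hlt.2)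
    have hr0 : 0 < r := (le_max_of_le_left (abs_nonneg _)).trans_lt hr1
    refine hout r⁻¹ ((one_lt_inv₀ hr0).2 hr2) ((h' _).2 ?_)
    simp only [Prod.smul_fst, Prod.smul_snd, smul_eq_mul]
    constructor
    · rw [show a * (r⁻¹ * y.1) + b * (r⁻¹ * y.2) = (a * y.1 + b * y.2) / r by field_simp,
        abs_div, abs_of_pos hr0, div_le_one hr0]
      exact (le_max_left _ _).trans hr1.le
    · rw [show c * (r⁻¹ * y.1) + d * (r⁻¹ * y.2) = (c * y.1 + d * y.2) / r by field_simp,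
        abs_div, abs_of_pos hr0, div_le_one hr0]
      exact (le_max_right _ _).trans hr1.le
  have m1 := (h' (1, 0)).1 (by norm_num [hexagon])
  have m2 := (h' (0, 1)).1 (by norm_num [hexagon])
  have m3 := (h' (1, 1)).1 (by norm_num [hexagon])
  have q1 := hfr (1, 1 / 2) (by norm_num [hexagon, abs_le]) (fun t ht hm => by
    have := (abs_le.1 hm.1).2
    simp at this
    linarith)
  have q2 := hfr (1 / 2, 1) (by norm_num [hexagon, abs_le]) (fun t ht hm => by
    have := (abs_le.1 hm.2.1).2
    simp at this
    linarith)
  have q3 := hfr (1 / 2, -1 / 2) (by norm_num [hexagon, abs_le]) (fun t ht hm => by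
    have := (abs_le.1 hm.2.2).2
    simp at this
    linarith)
  simp only [mul_one, mul_zero, add_zero, zero_add, abs_le, le_abs] at m1 m2 m3 q1 q2 q3
  have key : ∀ a b : ℝ, (-1 ≤ a ∧ a ≤ 1) → (-1 ≤ b ∧ b ≤ 1) → (-1 ≤ a + b ∧ a + b ≤ 1) →
      ((1 ≤ a + b * (1 / 2) ∨ 1 ≤ -(a + b * (1 / 2))) →
        ¬ (1 ≤ a * (1 / 2) + b ∨ 1 ≤ -(a * (1 / 2) + b)) ∧
        ¬ (1 ≤ a * (1 / 2) + b * (-1 / 2) ∨ 1 ≤ -(a * (1 / 2) + b * (-1 / 2)))) ∧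
      ((1 ≤ a * (1 / 2) + b ∨ 1 ≤ -(a * (1 / 2) + b)) →
        ¬ (1 ≤ a * (1 / 2) + b * (-1 / 2) ∨ 1 ≤ -(a * (1 / 2) + b * (-1 / 2)))) := by
    rintro a b ⟨ha1, ha2⟩ ⟨hb1, hb2⟩ ⟨hab1, hab2⟩
    refine ⟨fun h1 => ⟨fun h2 => ?_, fun h2 => ?_⟩, fun h1 h2 => ?_⟩ <;>
      rcases h1 with h1 | h1 <;> rcases h2 with h2 | h2 <;> linarith
  have k1 := key a b m1.1 m2.1 m3.1
  have k2 := key c d m1.2 m2.2 m3.2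
  rcases q1 with q1 | q1 <;> rcases q2 with q2 | q2 <;> rcases q3 with q3 | q3 <;>
    first
    | exact (k1.1 q1).1 q2
    | exact (k1.1 q1).2 q3
    | exact k1.2 q2 q3
    | exact (k2.1 q1).1 q2
    | exact (k2.1 q1).2 q3
    | exact k2.2 q2 q3

/-- A miserly domain has only one normalised supporting functional at each of its points. -/
lemma IsMiserly.supp_unique {K : Set (ℝ × ℝ)} (hK : IsMiserly K) {p : ℝ × ℝ} (hp : p ∈ K)
    {a₁ b₁ a₂ b₂ : ℝ} (h₁ : Supp K a₁ b₁) (h₂ : Supp K a₂ b₂)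
    (hp₁ : a₁ * p.1 + b₁ * p.2 = 1) (hp₂ : a₂ * p.1 + b₂ * p.2 = 1) :
    a₁ = a₂ ∧ b₁ = b₂ := by
  by_contra hne
  rw [not_and_or] at hne
  obtain ⟨v, z, hvz, hc, hpar⟩ := hK.parallelogram hp h₁ h₂ hp₁ hp₂ hne
  have h1 := one_le_deltaLat_of_parallelogram hvz hc hpar
  have hH : IsMiserly hexagon := ⟨isCSCD_hexagon, fun K' hK' =>
    (deltaLat_le_one isCSCD_hexagon).trans (h1.trans (hK.2 K' hK'))⟩
  obtain ⟨v', z', hvz', -, hpar'⟩ := hH.parallelogram (p := (1, 1)) (a₁ := 1) (b₁ := 0) (a₂ := 0)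
    (b₂ := 1) (by norm_num [hexagon])
    (fun x hx => by simpa using (abs_le.1 hx.1).2) (fun x hx => by simpa using (abs_le.1 hx.2.1).2)
    (by norm_num) (by norm_num) (by norm_num)
  exact hexagon_not_parallelogram hvz' hpar'

lemma pos_of_supporting {K : Set (ℝ × ℝ)} (hK : IsCSCD K) {f : (ℝ × ℝ) →ₗ[ℝ] ℝ} (hf : f ≠ 0)
    {p : ℝ × ℝ} (h : ∀ x ∈ K, f x ≤ f p) : 0 < f p := by
  by_contra! hle
  refine hf (LinearMap.ext fun y => ?_)
  have hlim : Filter.Tendsto (fun t : ℝ => t • y) (nhds 0) (nhds 0) := by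
    have : Continuous (fun t : ℝ => t • y) := by fun_prop
    simpa using this.tendsto 0
  obtain ⟨ε, hε, hball⟩ := Metric.eventually_nhds_iff.1
    (hlim.eventually (isOpen_interior.mem_nhds hK.zero_mem_interior))
  have hmem : (ε / 2) • y ∈ K := interior_subset (hball (by
    rw [Real.dist_eq, sub_zero, abs_of_pos (by linarith)]; linarith))
  have h1 := h _ hmem
  have h2 := h _ (hK.neg_mem hmem)
  simp only [map_neg, map_smul, smul_eq_mul] at h1 h2
  have h3 : ε / 2 * f y = 0 := by linarith
  simpa [hε.ne'] using h3

lemma supp_of_supporting {K : Set (ℝ × ℝ)} {f : (ℝ × ℝ) →ₗ[ℝ] ℝ} {p : ℝ × ℝ} (h0 : 0 < f p)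
    (h : ∀ x ∈ K, f x ≤ f p) : Supp K (f (1, 0) / f p) (f (0, 1) / f p) := fun x hx => by
  rw [div_mul_eq_mul_div, div_mul_eq_mul_div, ← add_div, ← linear_apply, div_le_one h0]
  exact h x hx

/-- A miserly domain has no corners. -/
theorem miserly_noCorners (K : Set (ℝ × ℝ)) (hK : IsMiserly K) : NoCorners K := by
  have hC := hK.1
  intro p hp
  have hpK : p ∈ K := hC.2.1.isClosed.frontier_subset hp
  obtain ⟨a, b, hs, hab⟩ := exists_supp_of_notMem_interior hC hp.2
  set f : (ℝ × ℝ) →ₗ[ℝ] ℝ := a • LinearMap.fst ℝ ℝ ℝ + b • LinearMap.snd ℝ ℝ ℝ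
  have hf : ∀ x, f x = a * x.1 + b * x.2 := fun x => rfl
  refine ⟨{x | f x = f p}, ⟨f, fun h0 => ?_, rfl, fun x hx => ?_⟩, ?_⟩
  · rw [← hf, h0] at hab
    simp at hab
  · rw [hf, hf, hab]
    exact hs x hx
  · rintro L ⟨g, hg, rfl, hgK⟩
    have h0 := pos_of_supporting hC hg hgK
    obtain ⟨ha, hb⟩ := hK.supp_unique hpK hs (supp_of_supporting h0 hgK) hab (by
      rw [div_mul_eq_mul_div, div_mul_eq_mul_div, ← add_div, ← linear_apply, div_self h0.ne'])
    ext x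
    rw [Set.mem_ofPred_eq, Set.mem_ofPred_eq, hf p, hab, hf, ha, hb, div_mul_eq_mul_div,
      div_mul_eq_mul_div, ← add_div, ← linear_apply, div_eq_one_iff_eq h0.ne']
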